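/- The space Λ³(ℝ^8)* of 3-forms on ℝ^8 decomposes as the direct sum Λ³_8 ⊕ Λ³_{48}, where Λ³_8 = {⋆(Φ ∧ η) : η a 1-form} has dimension 8 and Λ³_{48} = {γ : Φ ∧ γ = 0} has dimension 48, and these two subspaces are orthogonal with respect to the inner product on forms. -/

import Mathlib

open Finset

noncomputable section

/-- The exterior algebra of (ℝ^8)*, modeled as coefficient functions on basis index sets. -/
abbrev Form := Finset (Fin 8) → ℝ

/-- Sign `(-1)^{#{(i,j) ∈ t × u : j < i}}` arising when merging two wedge monomials. -/
def esign (t u : Finset (Fin 8)) : ℝ :=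
  (-1 : ℝ) ^ ((t ×ˢ u).filter (fun p => p.2 < p.1)).card

/-- Wedge product of forms. -/
def wedge (α β : Form) : Form := fun s =>
  ∑ t ∈ s.powerset, esign t (s \ t) * α t * β (s \ t)

/-- Hodge star for the standard Euclidean metric and orientation `e^{01234567}`,
characterized by `α ∧ ⋆β = ⟨α,β⟩ vol`. -/
def hodge (α : Form) : Form := fun u => esign uᶜ u * α uᶜ

/-- Inner product on forms, making the basis monomials orthonormal. -/
def formInner (α β : Form) : ℝ := ∑ s : Finset (Fin 8), α s * β s

/-- Basis monomial `e^{i₁} ∧ ⋯ ∧ e^{i_k}` for `s = {i₁ < ⋯ < i_k}`. -/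
def eS (s : Finset (Fin 8)) : Form := fun t => if t = s then 1 else 0

/-- `α` is a `k`-form. -/
def IsForm (k : ℕ) (α : Form) : Prop := ∀ s, s.card ≠ k → α s = 0

/-- The standard Cayley (Spin(7)) 4-form on ℝ^8. -/
def Phi : Form :=
  eS {0,1,2,3} - eS {0,1,4,5} - eS {0,1,6,7} - eS {0,2,4,6} + eS {0,2,5,7}
  - eS {0,3,4,7} - eS {0,3,5,6} + eS {4,5,6,7} - eS {2,3,6,7} - eS {2,3,4,5}
  - eS {1,3,5,7} + eS {1,3,4,6} - eS {1,2,5,6} - eS {1,2,4,7}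

/-- Interior product with the basis vector `e_i`. -/
def iota (i : Fin 8) (α : Form) : Form := fun s =>
  if i ∈ s then 0 else (-1 : ℝ) ^ (s.filter (· < i)).card * α (insert i s)

/-- Interior product with the vector `v`. -/
def iotaV (v : Fin 8 → ℝ) (α : Form) : Form := fun s => ∑ i, v i * iota i α s

/-- Musical isomorphism `♭ : ℝ^8 → Λ¹(ℝ^8)*`. -/
def flat (v : Fin 8 → ℝ) : Form := fun s => ∑ i, v i * eS {i} s

/-- Projection onto `Λ²_7` (eigenvalue 3 of `ω ↦ ⋆(Φ ∧ ω)`). -/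
def proj7 (α : Form) : Form := (4 : ℝ)⁻¹ • (α + hodge (wedge Phi α))

/-- Projection onto `Λ²_21` (eigenvalue -1 of `ω ↦ ⋆(Φ ∧ ω)`). -/
def proj21 (α : Form) : Form := (4 : ℝ)⁻¹ • ((3 : ℝ) • α - hodge (wedge Phi α))

/-- Evaluation of a 4-form on four vectors. -/
def ev4 (α : Form) (x y z w : Fin 8 → ℝ) : ℝ :=
  iotaV w (iotaV z (iotaV y (iotaV x α))) ∅

/-- Standard inner product on ℝ^8. -/
def dot (u v : Fin 8 → ℝ) : ℝ := ∑ i, u i * v i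

/-- Standard basis vector. -/
def std (i : Fin 8) : Fin 8 → ℝ := fun j => if j = i then 1 else 0

/-- Hodge star as a linear map. -/
def hodgeL : Form →ₗ[ℝ] Form where
  toFun := hodge
  map_add' α β := by funext u; simp [hodge, mul_add]
  map_smul' c α := by funext u; simp [hodge]; ring

/-- Wedge with a fixed form, as a linear map. -/
def wedgeL (α : Form) : Form →ₗ[ℝ] Form where
  toFun β := wedge α β
  map_add' β γ := by
    funext s
    simp [wedge, mul_add, Finset.sum_add_distrib]
  map_smul' c β := by
    funext s
    simp only [wedge, Pi.smul_apply, smul_eq_mul, RingHom.id_apply]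
    rw [Finset.mul_sum]
    exact Finset.sum_congr rfl fun t _ => by ring

/-- The subspace of `k`-forms. -/
def FormK (k : ℕ) : Submodule ℝ Form where
  carrier := {α | IsForm k α}
  add_mem' := by intro a b ha hb s hs; simp [Pi.add_apply, ha s hs, hb s hs]
  zero_mem' := by intro s _; rfl
  smul_mem' := by intro c α ha s hs; simp [Pi.smul_apply, ha s hs]
end

noncomputable section

/-- `Λ³_8 = {⋆(Φ ∧ η) : η a 1-form}`. -/
def Lambda3_8 : Submodule ℝ Form := (FormK 1).map (hodgeL ∘ₗ wedgeL Phi)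

/-- `Λ³_48 = {γ a 3-form : Φ ∧ γ = 0}`. -/
def Lambda3_48 : Submodule ℝ Form := FormK 3 ⊓ LinearMap.ker (wedgeL Phi)

/-- Integer version of `esign`. -/
def esignZ (t u : Finset (Fin 8)) : ℤ :=
  (-1 : ℤ) ^ ((t ×ˢ u).filter (fun p => p.2 < p.1)).card

/-- Integer basis monomial coefficients. -/
def eZ (s t : Finset (Fin 8)) : ℤ := if t = s then 1 else 0

/-- Integer version of `Phi`. -/
def PhiZ (t : Finset (Fin 8)) : ℤ :=
  eZ {0,1,2,3} t - eZ {0,1,4,5} t - eZ {0,1,6,7} t - eZ {0,2,4,6} t + eZ {0,2,5,7} t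
  - eZ {0,3,4,7} t - eZ {0,3,5,6} t + eZ {4,5,6,7} t - eZ {2,3,6,7} t - eZ {2,3,4,5} t
  - eZ {1,3,5,7} t + eZ {1,3,4,6} t - eZ {1,2,5,6} t - eZ {1,2,4,7} t

/-- Coefficient of `e^s` in `⋆(Φ ∧ e^i)`. -/
def aZ (i : Fin 8) (s : Finset (Fin 8)) : ℤ :=
  if i ∈ s ∨ s.card ≠ 3 then 0 else
    esignZ sᶜ s * (esignZ (sᶜ \ {i}) {i} * PhiZ (sᶜ \ {i}))

lemma esign_cast (t u : Finset (Fin 8)) : esign t u = (esignZ t u : ℝ) := by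
  simp [esign, esignZ]

lemma Phi_cast (t : Finset (Fin 8)) : Phi t = (PhiZ t : ℝ) := by
  simp only [Phi, PhiZ, eS, eZ, Pi.add_apply, Pi.sub_apply]
  push_cast
  rfl

lemma eZ_card (s t : Finset (Fin 8)) (hs : s.card = 4) (h : t.card ≠ 4) : eZ s t = 0 := by
  rw [eZ, if_neg]
  rintro rfl
  exact h hs

lemma PhiZ_card (t : Finset (Fin 8)) (h : t.card ≠ 4) : PhiZ t = 0 := by
  unfold PhiZ
  repeat rw [eZ_card _ t rfl h]
  rfl

lemma Phi_card (t : Finset (Fin 8)) (h : t.card ≠ 4) : Phi t = 0 := by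
  rw [Phi_cast, PhiZ_card t h]; simp

lemma esignZ_compare : ∀ s : Finset (Fin 8), s.card = 3 → ∀ i : Fin 8, i ∉ s →
    esignZ (sᶜ \ {i}) s = (-1) ^ (i : ℕ) * (esignZ sᶜ s * esignZ (sᶜ \ {i}) {i}) := by
  decide +kernel

lemma aZ_compare (i : Fin 8) (s : Finset (Fin 8)) (hi : i ∉ s) (hs : s.card = 3) :
    esignZ (({i}ᶜ : Finset (Fin 8)) \ s) s * PhiZ ({i}ᶜ \ s) = (-1) ^ (i : ℕ) * aZ i s := by
  have h : ({i}ᶜ : Finset (Fin 8)) \ s = sᶜ \ {i} := by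
    ext j
    simp [and_comm]
  have h2 : ¬ (i ∈ s ∨ s.card ≠ 3) := by simp [hi, hs]
  rw [h, aZ, if_neg h2, esignZ_compare s hs i hi]
  ring

lemma aZ_orth_le : ∀ i j : Fin 8, i ≤ j →
    ∑ s : Finset (Fin 8), aZ i s * aZ j s = if i = j then 7 else 0 := by
  decide +kernel

lemma aZ_orth (i j : Fin 8) :
    ∑ s : Finset (Fin 8), aZ i s * aZ j s = if i = j then 7 else 0 := by
  rcases le_total i j with h | h
  · exact aZ_orth_le i j h
  · have := aZ_orth_le j i h
    simp only [mul_comm (aZ i _), this, eq_comm]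

/-- Wedge product, summed over the second factor. -/
lemma wedge_swap (α β : Form) (u : Finset (Fin 8)) :
    wedge α β u = ∑ t ∈ u.powerset, esign (u \ t) t * α (u \ t) * β t := by
  unfold wedge
  refine Finset.sum_bij' (fun t _ => u \ t) (fun t _ => u \ t) ?_ ?_ ?_ ?_ ?_
  · intro t _; simp
  · intro t _; simp
  · intro t ht; simpa using ht
  · intro t ht; simpa using ht
  · intro t ht
    have : u \ (u \ t) = t := by simpa using ht
    rw [this]

/-- The map `η ↦ ⋆(Φ ∧ η)` in coordinates. -/
def mapA : (Fin 8 → ℝ) →ₗ[ℝ] Form where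
  toFun v := fun s => ∑ i, (aZ i s : ℝ) * v i
  map_add' v w := by
    funext s; simp [mul_add, Finset.sum_add_distrib]
  map_smul' c v := by
    funext s
    simp only [Pi.smul_apply, smul_eq_mul, RingHom.id_apply, Finset.mul_sum]
    exact Finset.sum_congr rfl fun t _ => by ring

/-- The transpose of `mapA`. -/
def mapB : Form →ₗ[ℝ] (Fin 8 → ℝ) where
  toFun γ := fun i => ∑ s, (aZ i s : ℝ) * γ s
  map_add' v w := by
    funext s; simp [mul_add, Finset.sum_add_distrib]
  map_smul' c v := by
    funext s
    simp only [Pi.smul_apply, smul_eq_mul, RingHom.id_apply, Finset.mul_sum]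
    exact Finset.sum_congr rfl fun t _ => by ring

lemma mapB_mapA (v : Fin 8 → ℝ) : mapB (mapA v) = (7 : ℝ) • v := by
  funext i
  change ∑ s, (aZ i s : ℝ) * ∑ j, (aZ j s : ℝ) * v j = 7 * v i
  simp only [Finset.mul_sum]
  rw [Finset.sum_comm]
  have h : ∀ j, ∑ s, (aZ i s : ℝ) * ((aZ j s : ℝ) * v j) = (if i = j then 7 else 0) * v j := by
    intro j
    have := congrArg (fun z : ℤ => (z : ℝ)) (aZ_orth i j)
    push_cast at this
    rw [← this, Finset.sum_mul]
    exact Finset.sum_congr rfl fun t _ => by ring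
  simp [h]

lemma mapA_injective : Function.Injective mapA := by
  intro v w h
  have := congrArg mapB h
  rw [mapB_mapA, mapB_mapA] at this
  exact smul_right_injective _ (by norm_num : (7 : ℝ) ≠ 0) this

lemma mapA_mem (v : Fin 8 → ℝ) : mapA v ∈ FormK 3 := by
  intro s hs
  change ∑ i, (aZ i s : ℝ) * v i = 0
  exact Finset.sum_eq_zero fun i _ => by simp [aZ, hs]

lemma formInner_mapA (v : Fin 8 → ℝ) (γ : Form) :
    formInner (mapA v) γ = ∑ i, v i * mapB γ i := by
  change ∑ s, (∑ i, (aZ i s : ℝ) * v i) * γ s = ∑ i, v i * ∑ s, (aZ i s : ℝ) * γ s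
  simp only [Finset.mul_sum, Finset.sum_mul]
  rw [Finset.sum_comm]
  exact Finset.sum_congr rfl fun i _ => Finset.sum_congr rfl fun t _ => by ring

lemma sum_one_form (f : Finset (Fin 8) → ℝ) (u : Finset (Fin 8))
    (hf : ∀ t, t.card ≠ 1 → f t = 0) :
    ∑ t ∈ u.powerset, f t = ∑ i ∈ u, f {i} := by
  symm
  have himg : ∑ i ∈ u, f {i} = ∑ t ∈ u.image (fun i => ({i} : Finset (Fin 8))), f t := by
    rw [Finset.sum_image]
    intro x _ y _ h
    simpa using h
  rw [himg]
  apply Finset.sum_subset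
  · intro t ht
    simp only [Finset.mem_image] at ht
    obtain ⟨i, hi, rfl⟩ := ht
    simpa using hi
  · intro t ht hnt
    apply hf
    intro hc
    obtain ⟨i, rfl⟩ := Finset.card_eq_one.mp hc
    apply hnt
    simp only [Finset.mem_image]
    exact ⟨i, by simpa using ht, rfl⟩

lemma hodge_wedge_one (η : Form) (hη : IsForm 1 η) :
    hodge (wedge Phi η) = mapA (fun i => η {i}) := by
  funext s
  change esign sᶜ s * wedge Phi η sᶜ = ∑ i, (aZ i s : ℝ) * η {i}
  rw [wedge_swap, sum_one_form _ _ (fun t ht => by rw [hη t ht, mul_zero]), Finset.mul_sum,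
    ← Finset.sum_subset (Finset.subset_univ sᶜ)]
  · refine Finset.sum_congr rfl fun i hi => ?_
    have his : i ∉ s := by simpa using hi
    by_cases hs : s.card = 3
    · simp only [aZ, his, hs, esign_cast, Phi_cast]
      simp
      ring
    · have hc : (sᶜ \ {i}).card ≠ 4 := by
        rw [Finset.card_sdiff_of_subset (by simpa using hi), Finset.card_compl]
        have : s.card ≤ 8 := by simpa using Finset.card_le_univ s
        simp
        omega
      simp [aZ, hs, Phi_card _ hc]
  · intro i _ hi
    have his : i ∈ s := by simpa using hi
    simp [aZ, his]

lemma wedge_three_compl (γ : Form) (hγ : IsForm 3 γ) (i : Fin 8) :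
    wedge Phi γ {i}ᶜ = (-1) ^ (i : ℕ) * mapB γ i := by
  change _ = (-1) ^ (i : ℕ) * ∑ s, (aZ i s : ℝ) * γ s
  rw [wedge_swap, Finset.mul_sum, ← Finset.sum_subset (Finset.subset_univ _)]
  · refine Finset.sum_congr rfl fun s hs => ?_
    have his : i ∉ s := by
      intro h
      have := (Finset.mem_powerset.mp hs) h
      simp at this
    by_cases hc : s.card = 3
    · have := congrArg (fun z : ℤ => (z : ℝ)) (aZ_compare i s his hc)
      push_cast at this
      rw [esign_cast, Phi_cast, this]
      ring
    · simp [hγ s hc]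
  · intro s _ hs
    have his : i ∈ s := by
      by_contra h
      apply hs
      rw [Finset.mem_powerset]
      intro j hj
      simp only [Finset.mem_compl, Finset.mem_singleton]
      rintro rfl
      exact h hj
    simp [aZ, his]

lemma wedge_three_zero (γ : Form) (hγ : IsForm 3 γ) (u : Finset (Fin 8)) (hu : u.card ≠ 7) :
    wedge Phi γ u = 0 := by
  rw [wedge_swap]
  refine Finset.sum_eq_zero fun s hs => ?_
  by_cases hc : s.card = 3
  · have hsu := Finset.mem_powerset.mp hs
    have h4 : (u \ s).card ≠ 4 := by
      have := Finset.card_sdiff_add_card_eq_card hsu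
      omega
    simp [Phi_card _ h4]
  · simp [hγ s hc]

lemma wedge_three_iff (γ : Form) (hγ : IsForm 3 γ) : wedge Phi γ = 0 ↔ mapB γ = 0 := by
  constructor
  · intro h
    funext i
    have h1 := wedge_three_compl γ hγ i
    rw [h] at h1
    have h2 : ((-1 : ℝ)) ^ (i : ℕ) ≠ 0 := pow_ne_zero _ (by norm_num)
    exact (mul_eq_zero.mp h1.symm).resolve_left h2
  · intro h
    funext u
    by_cases hu : u.card = 7
    · have h1 : uᶜ.card = 1 := by
        rw [Finset.card_compl, hu]; rfl
      obtain ⟨i, hi⟩ := Finset.card_eq_one.mp h1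
      have : u = {i}ᶜ := by rw [← hi, compl_compl]
      rw [this, wedge_three_compl γ hγ i, h]
      simp
    · exact wedge_three_zero γ hγ u hu

lemma Lambda3_8_eq : Lambda3_8 = LinearMap.range mapA := by
  ext α
  constructor
  · rintro ⟨η, hη, rfl⟩
    exact ⟨fun i => η {i}, (hodge_wedge_one η hη).symm⟩
  · rintro ⟨v, rfl⟩
    have hf : IsForm 1 (flat v) := by
      intro s hs
      refine Finset.sum_eq_zero fun i _ => ?_
      have : s ≠ {i} := by rintro rfl; simp at hs
      simp [eS, this]
    refine ⟨flat v, hf, ?_⟩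
    refine (hodge_wedge_one (flat v) hf).trans ?_
    congr 1
    funext i
    simp [flat, eS]

lemma Lambda3_48_eq : Lambda3_48 = FormK 3 ⊓ LinearMap.ker mapB := by
  ext γ
  constructor
  · rintro ⟨h3, hk⟩
    exact ⟨h3, (wedge_three_iff γ h3).mp hk⟩
  · rintro ⟨h3, hk⟩
    exact ⟨h3, (wedge_three_iff γ h3).mpr hk⟩

/-- `k`-forms are functions on the `k`-element subsets. -/
def formKEquiv (k : ℕ) : FormK k ≃ₗ[ℝ] ({s : Finset (Fin 8) // s.card = k} → ℝ) where
  toFun α := fun s => α.1 s.1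
  map_add' _ _ := rfl
  map_smul' _ _ := rfl
  invFun f := ⟨fun s => if h : s.card = k then f ⟨s, h⟩ else 0, fun s hs => by simp [hs]⟩
  left_inv α := by
    ext s
    by_cases h : s.card = k
    · simp [h]
    · simp [h, α.2 s h]
  right_inv f := by
    funext s
    simp [s.2]

lemma finrank_FormK3 : Module.finrank ℝ (FormK 3) = 56 := by
  rw [(formKEquiv 3).finrank_eq, Module.finrank_fintype_fun_eq_card, Fintype.card_finset_len]
  rfl

/-- Λ³(ℝ^8)* = Λ³_8 ⊕ Λ³_48 with dim Λ³_8 = 8, dim Λ³_48 = 48,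
and the two subspaces are orthogonal. -/
theorem lambda3_decomposition :
    Module.finrank ℝ Lambda3_8 = 8 ∧
    Module.finrank ℝ Lambda3_48 = 48 ∧
    (∀ α ∈ Lambda3_8, ∀ β ∈ Lambda3_48, formInner α β = 0) ∧
    Lambda3_8 ⊔ Lambda3_48 = FormK 3 ∧
    Lambda3_8 ⊓ Lambda3_48 = ⊥ := by
  have h8 : Module.finrank ℝ Lambda3_8 = 8 := by
    rw [Lambda3_8_eq, LinearMap.finrank_range_of_inj mapA_injective]
    simp
  have hsup : Lambda3_8 ⊔ Lambda3_48 = FormK 3 := by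
    rw [Lambda3_8_eq, Lambda3_48_eq]
    apply le_antisymm
    · refine sup_le ?_ inf_le_left
      rintro _ ⟨v, rfl⟩
      exact mapA_mem v
    · intro γ hγ
      rw [Submodule.mem_sup]
      refine ⟨mapA ((7 : ℝ)⁻¹ • mapB γ), ⟨_, rfl⟩, γ - mapA ((7 : ℝ)⁻¹ • mapB γ), ⟨?_, ?_⟩, ?_⟩
      · exact Submodule.sub_mem _ hγ (mapA_mem _)
      · change mapB _ = 0
        rw [map_sub, mapB_mapA, smul_smul]
        norm_num
      · abel
  have hinf : Lambda3_8 ⊓ Lambda3_48 = ⊥ := by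
    rw [Lambda3_8_eq, Lambda3_48_eq, eq_bot_iff]
    rintro _ ⟨⟨v, rfl⟩, _, hk⟩
    have hk' : mapB (mapA v) = 0 := hk
    rw [mapB_mapA] at hk'
    have hv : v = 0 := (smul_eq_zero.mp hk').resolve_left (by norm_num)
    simp [hv]
  refine ⟨h8, ?_, ?_, hsup, hinf⟩
  · have h := Submodule.finrank_sup_add_finrank_inf_eq Lambda3_8 Lambda3_48
    rw [hsup, hinf, h8, finrank_FormK3, finrank_bot] at h
    omega
  · intro α hα β hβ
    rw [Lambda3_8_eq] at hα
    rw [Lambda3_48_eq] at hβ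
    obtain ⟨v, rfl⟩ := hα
    have hk : mapB β = 0 := hβ.2
    rw [formInner_mapA, hk]
    simp

end
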